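/- With H(b_i ⊗ b_j) = max(i, 2−j) − 1, the generating function of multi-grounded partitions in ²𝒫^≫_{c_2 c_0} satisfies: ∑_{π ∈ ²𝒫^≫_{c_2 c_0}} C(π) q^{|π|} = c_0 c_2 (−c_0 q; q²)_∞ (−c_2 q; q²)_∞ / ((c_1 q; q²)_∞ (c_0 c_2 q⁴; q⁴)_∞), valid for complex q, c_0, c_1, c_2 with |q| < 1 and |c_0|, |c_1|, |c_2| ≤ 1. -/

import Mathlib

open scoped BigOperators

/-- The infinite q-Pochhammer symbol `(a; q)_∞ = ∏_{k≥0} (1 - a qᵏ)`. -/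
noncomputable def qPoch (a q : ℂ) : ℂ := ∏' k : ℕ, (1 - a * q ^ k)

/-- The energy function `H(b_i ⊗ b_j) = max(i, 2−j) − 1` for the level-2 perfect crystal
of `A_1^{(1)}`, with `i, j ∈ {0,1,2}`, valued in `ℤ`. -/
def H2 (i j : ℕ) : ℤ := max (i : ℤ) (2 - (j : ℤ)) - 1

/-- The step condition: writing `x = π_k` and `y = π_{k+1}` as pairs (part, colour), it requires
`p_k − p_{k+1} − 2H(b_{a_{k+1}} ⊗ b_{a_k}) ∈ 2ℤ_{≥0}`. -/
def Step2 (x y : ℤ × ℕ) : Prop := ∃ t : ℕ, x.1 - y.1 - 2 * H2 y.2 x.2 = 2 * (t : ℤ)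

/-- Multi-grounded partitions in `²𝒫^≫_{c_2 c_0}`: lists of (part, colour) pairs with colours
in `{0,1,2}`, all consecutive steps satisfying the condition `Step2`, whose last two parts are
`−1` coloured `c_2` and `1` coloured `c_0`, and such that the two parts preceding this tail are
not `(−1)_{c_2}, 1_{c_0}`. -/
def MG20 (L : List (ℤ × ℕ)) : Prop :=
  (∀ p ∈ L, p.2 ≤ 2) ∧ List.Chain' Step2 L ∧
    ∃ M, L = M ++ [((-1 : ℤ), 2), ((1 : ℤ), 0)] ∧
      ¬ ∃ M', M = M' ++ [((-1 : ℤ), 2), ((1 : ℤ), 0)]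

/-- The generating function `∑_π C(π) q^{|π|}` over all lists satisfying a predicate `P`, where
`C(π) = c_0^A c_1^B c_2^D` records the numbers of parts of each colour, and `|π|` is the sum
of the parts. -/
noncomputable def genFun (P : List (ℤ × ℕ) → Prop) (q c0 c1 c2 : ℂ) : ℂ :=
  ∑' L : {L : List (ℤ × ℕ) // P L},
    c0 ^ (L.1.countP fun p => p.2 == 0) * c1 ^ (L.1.countP fun p => p.2 == 1) *
      c2 ^ (L.1.countP fun p => p.2 == 2) * q ^ ((L.1.map Prod.fst).sum)

open Filter Topology

/-- If `T` is the disjoint union of `U` and `φ '' T`, where `φ` scales `f` by a factor `r` of norm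
less than one, then the sum of `f` over `T` is the geometric multiple `S / (1 - r)` of its sum `S`
over `U`. -/
theorem HasSum.div_one_sub_of_eq_union_image {α : Type*} {f : α → ℂ} {φ : α → α}
    (hφ : Function.Injective φ) {T U : Set α} (hT : T = U ∪ φ '' T) (hd : Disjoint U (φ '' T))
    {m : α → ℕ} (hm : ∀ x, m x < m (φ x)) {r : ℂ} (hf : ∀ x ∈ T, f (φ x) = r * f x)
    (hr : ‖r‖ < 1) {S : ℂ} (hS : HasSum (fun x : U => f x) S) :
    HasSum (fun x : T => f x) (S / (1 - r)) := by
  have hUT : U ⊆ T := hT ▸ Set.subset_union_left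
  have hφT : ∀ x ∈ T, φ x ∈ T := fun x hx => by
    rw [hT]; exact Or.inr ⟨x, hx, rfl⟩
  have hiter : ∀ k : ℕ, ∀ x ∈ T, φ^[k] x ∈ T ∧ f (φ^[k] x) = r ^ k * f x := by
    intro k x hx
    induction k with
    | zero => simpa using hx
    | succ k ih =>
      rw [Function.iterate_succ_apply']
      exact ⟨hφT _ ih.1, by rw [hf _ ih.1, ih.2]; ring⟩
  let e : ℕ × U → T := fun x => ⟨φ^[x.1] x.2, (hiter x.1 x.2 (hUT x.2.2)).1⟩
  have key : ∀ (k d : ℕ) (u v : U), φ^[k] (u : α) = φ^[k + d] (v : α) → d = 0 := by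
    intro k d u v h
    rw [Function.iterate_add_apply] at h
    have h' := hφ.iterate k h
    cases d with
    | zero => rfl
    | succ d =>
      rw [Function.iterate_succ_apply'] at h'
      exact (Set.disjoint_left.1 hd u.2 (h' ▸ ⟨_, (hiter d v (hUT v.2)).1, rfl⟩)).elim
  have he : Function.Bijective e := by
    constructor
    · rintro ⟨k, u⟩ ⟨l, v⟩ h
      have h : φ^[k] (u : α) = φ^[l] (v : α) := congrArg Subtype.val h
      have hkl : k = l := by
        rcases le_total k l with hkl | hkl
        · obtain ⟨d, rfl⟩ := Nat.exists_eq_add_of_le hkl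
          rw [key k d u v h, add_zero]
        · obtain ⟨d, rfl⟩ := Nat.exists_eq_add_of_le hkl
          rw [key l d v u h.symm, add_zero]
      subst hkl
      rw [Subtype.ext (hφ.iterate k h)]
    · rintro ⟨x, hx⟩
      induction hn : m x using Nat.strong_induction_on generalizing x with
      | _ n ih =>
        have hx' := hx
        rw [hT] at hx'
        rcases hx' with hx' | ⟨y, hy, rfl⟩
        · exact ⟨(0, ⟨x, hx'⟩), rfl⟩
        · obtain ⟨⟨k, u⟩, hku⟩ := ih (m y) (hn ▸ hm y) y hy rfl
          refine ⟨(k + 1, u), Subtype.ext ?_⟩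
          simp only [e, Function.iterate_succ_apply']
          exact congrArg φ (congrArg Subtype.val hku)
  rw [← (Equiv.ofBijective e he).hasSum_iff, div_eq_inv_mul]
  have hg := hasSum_geometric_of_norm_lt_one hr
  have hfe : (fun x : T => f x) ∘ Equiv.ofBijective e he = fun x : ℕ × U => r ^ x.1 * f x.2 :=
    funext fun x => (hiter x.1 x.2 (hUT x.2.2)).2
  rw [hfe]
  have hs : Summable fun x : ℕ × U => r ^ x.1 * f x.2 :=
    summable_mul_of_summable_norm (f := fun k : ℕ => r ^ k) (g := fun u : U => f u)
      hg.summable.norm hS.summable.norm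
  exact HasSum.mul (f := fun k : ℕ => r ^ k) (g := fun u : U => f u) hg hS hs

/-- The sum of `f` over the disjoint union of `U` and `φ '' V`, where `φ` scales `f` by `r`. -/
theorem HasSum.union_image_of_eq_mul {α : Type*} {f : α → ℂ} {φ : α → α}
    (hφ : Function.Injective φ) {U V : Set α} (hd : Disjoint U (φ '' V)) {r : ℂ}
    (hf : ∀ x ∈ V, f (φ x) = r * f x) {S S' : ℂ} (hS : HasSum (fun x : U => f x) S)
    (hS' : HasSum (fun x : V => f x) S') :
    HasSum (fun x : (U ∪ φ '' V : Set α) => f x) (S + r * S') := by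
  refine HasSum.add_disjoint (f := f) hd hS ?_
  rw [← (Equiv.Set.image φ V hφ).hasSum_iff]
  have hfe : (fun x : φ '' V => f x) ∘ Equiv.Set.image φ V hφ = fun x : V => r * f x :=
    funext fun x => hf x x.2
  exact hfe ▸ hS'.mul_left r

/-- Coloured sequences ending with the ground `(-1)_{c_2}, 1_{c_0}` all of whose other parts are
positive. -/
inductive Grounded : List (ℤ × ℕ) → Prop
  | ground : Grounded [(-1, 2), (1, 0)]
  | cons {x y : ℤ × ℕ} {L : List (ℤ × ℕ)} : Grounded (y :: L) → x.2 ≤ 2 → Step2 x y → 1 ≤ x.1 →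
      Grounded (x :: y :: L)

theorem step2_iff {x y : ℤ × ℕ} :
    Step2 x y ↔ ∃ t : ℕ, x.1 - y.1 - 2 * (max (y.2 : ℤ) (2 - x.2) - 1) = 2 * (t : ℤ) := Iff.rfl

namespace Grounded

theorem exists_eq_cons {L : List (ℤ × ℕ)} (h : Grounded L) :
    ∃ y L', L = y :: L' ∧ y.2 ≤ 2 ∧ -1 ≤ y.1 ∧ y.1 % 2 = 1 ∧ (y.1 = -1 → y.2 = 2) := by
  induction h with
  | ground => exact ⟨_, _, rfl, by simp⟩
  | @cons x y L hL hx hs h1 ih =>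
    obtain ⟨z, L', h, h2, h3, h4, h5⟩ := ih
    obtain ⟨rfl, rfl⟩ := List.cons.inj h
    obtain ⟨t, ht⟩ := step2_iff.1 hs
    exact ⟨_, _, rfl, hx, by omega, by omega, by omega⟩

theorem eq_ground_of_neg {y : ℤ × ℕ} {L : List (ℤ × ℕ)} (h : Grounded (y :: L)) (hy : y.1 < 1) :
    y :: L = [(-1, 2), (1, 0)] := by
  cases h with
  | ground => rfl
  | cons _ _ _ h1 => omega

theorem sum_nonneg {L : List (ℤ × ℕ)} (h : Grounded L) : 0 ≤ (L.map Prod.fst).sum := by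
  induction h with
  | ground => simp
  | cons _ _ _ h1 ih => simp only [List.map_cons, List.sum_cons] at ih ⊢; omega

theorem mg20 {L : List (ℤ × ℕ)} (h : Grounded L) : MG20 L := by
  suffices H : (∀ p ∈ L, p.2 ≤ 2) ∧ List.IsChain Step2 L ∧
      ∃ M, L = M ++ [((-1 : ℤ), 2), ((1 : ℤ), 0)] ∧ ∀ p ∈ M, 1 ≤ p.1 by
    obtain ⟨h1, h2, M, h3, h4⟩ := H
    refine ⟨h1, h2, M, h3, ?_⟩
    rintro ⟨M', rfl⟩
    have := h4 (-1, 2) (by simp)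
    omega
  induction h with
  | ground => exact ⟨by simp, by simp [step2_iff], [], by simp⟩
  | @cons x y L hL hx hs h1 ih =>
    obtain ⟨h2, h3, M, h4, h5⟩ := ih
    refine ⟨List.forall_mem_cons.2 ⟨hx, h2⟩, List.isChain_cons_cons.2 ⟨hs, h3⟩, x :: M, ?_,
      List.forall_mem_cons.2 ⟨h1, h5⟩⟩
    rw [h4, List.cons_append]

end Grounded

theorem MG20.grounded {L : List (ℤ × ℕ)} (h : MG20 L) : Grounded L := by
  obtain ⟨h1, h2, M, rfl, hM⟩ := h
  induction M with
  | nil => exact .ground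
  | cons x M ih =>
    rw [List.cons_append] at h1 h2 ⊢
    have hG := ih (fun ⟨M', hM'⟩ => hM ⟨x :: M', by rw [hM', List.cons_append]⟩)
      (List.forall_mem_cons.1 h1).2 h2.tail
    obtain ⟨y, L, hyL, hy2, hy1, hyo, hyn⟩ := hG.exists_eq_cons
    rw [hyL] at hG h2 h1 ⊢
    have hs := (List.isChain_cons_cons.1 h2).1
    have hx2 := h1 x (by simp)
    refine .cons hG hx2 hs ?_
    obtain ⟨t, ht⟩ := step2_iff.1 hs
    by_contra! hx
    have hx' : x = (-1, 2) := by ext <;> simp <;> omega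
    have hy' : y = (1, 0) := by subst hx'; ext <;> simp at * <;> omega
    subst hx' hy'
    cases hG with
    | @cons _ z L hL _ hs _ =>
      obtain ⟨t, ht⟩ := step2_iff.1 hs
      have hL := hL.eq_ground_of_neg (by simp at ht; omega)
      rw [hL] at hyL
      have : M ++ [((-1 : ℤ), 2), ((1 : ℤ), 0)] = [(1, 0)] ++ [((-1 : ℤ), 2), ((1 : ℤ), 0)] := hyL
      rw [List.append_cancel_right this] at hM
      exact hM ⟨[], rfl⟩

theorem mg20_iff_grounded {L : List (ℤ × ℕ)} : MG20 L ↔ Grounded L :=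
  ⟨MG20.grounded, Grounded.mg20⟩

/-- The sequences in `²𝒫^≫_{c_2 c_0}` to which the part `2n + 1` of colour `c_a` may be
prepended. -/
def tails (a n : ℕ) : Set (List (ℤ × ℕ)) := {L | Grounded ((2 * (n : ℤ) + 1, a) :: L)}

theorem mem_tails {a n : ℕ} {L : List (ℤ × ℕ)} (ha : a ≤ 2) :
    L ∈ tails a n ↔ Grounded L ∧ ∃ y L', L = y :: L' ∧ Step2 (2 * (n : ℤ) + 1, a) y := by
  constructor
  · intro h
    obtain _ | ⟨hL, _, hs, _⟩ := id h
    exact ⟨hL, _, _, rfl, hs⟩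
  · rintro ⟨h, y, L', rfl, hs⟩
    exact .cons h ha hs (by simp)

theorem step2_iff_le {a n : ℕ} {y : ℤ × ℕ} (hy : y.1 % 2 = 1) :
    Step2 (2 * (n : ℤ) + 1, a) y ↔ y.1 + 2 * max (y.2 : ℤ) (2 - a) ≤ 2 * n + 3 := by
  rw [step2_iff]
  refine ⟨fun ⟨t, ht⟩ => by simp only at ht; omega, fun h => ?_⟩
  refine ⟨((2 * n + 3 - y.1 - 2 * max (y.2 : ℤ) (2 - a)) / 2).toNat, ?_⟩
  simp only
  omega

theorem mem_tails_iff {a n : ℕ} {L : List (ℤ × ℕ)} (ha : a ≤ 2) :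
    L ∈ tails a n ↔ Grounded L ∧ ∃ y L', L = y :: L' ∧ y.2 ≤ 2 ∧ -1 ≤ y.1 ∧ y.1 % 2 = 1 ∧
      (y.1 = -1 → y.2 = 2) ∧ y.1 + 2 * max (y.2 : ℤ) (2 - a) ≤ 2 * n + 3 := by
  rw [mem_tails ha]
  refine and_congr_right fun h => ?_
  obtain ⟨y, L', rfl, h2, h3, h4, h5⟩ := h.exists_eq_cons
  constructor
  · rintro ⟨_, _, he, hs⟩
    obtain ⟨rfl, rfl⟩ := List.cons.inj he
    exact ⟨_, _, rfl, h2, h3, h4, h5, (step2_iff_le h4).1 hs⟩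
  · rintro ⟨_, _, he, -, -, -, -, hs⟩
    obtain ⟨rfl, rfl⟩ := List.cons.inj he
    exact ⟨_, _, rfl, (step2_iff_le h4).2 hs⟩

theorem cons_mem_tails_iff {a b m n : ℕ} {L : List (ℤ × ℕ)} (ha : a ≤ 2) (hb : b ≤ 2) :
    (2 * (m : ℤ) + 1, b) :: L ∈ tails a n ↔
      L ∈ tails b m ∧ 2 * (m : ℤ) + 2 * max (b : ℤ) (2 - a) ≤ 2 * n + 2 := by
  rw [mem_tails_iff ha]
  refine and_congr_right fun _ => ⟨?_, fun h => ⟨_, _, rfl, hb, ?_⟩⟩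
  · rintro ⟨_, _, he, -, -, -, -, h⟩
    obtain ⟨rfl, rfl⟩ := List.cons.inj he
    simp only at h
    omega
  · simp only
    omega

theorem tails_zero_subset_one (n : ℕ) : tails 0 n ⊆ tails 1 n := by
  intro L hL
  rw [mem_tails_iff (by norm_num)] at hL ⊢
  obtain ⟨hL, y, L', rfl, h⟩ := hL
  exact ⟨hL, y, L', rfl, by omega⟩

theorem tails_one_subset_zero_succ (n : ℕ) : tails 1 n ⊆ tails 0 (n + 1) := by
  intro L hL
  rw [mem_tails_iff (by norm_num)] at hL ⊢
  obtain ⟨hL, y, L', rfl, h⟩ := hL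
  exact ⟨hL, y, L', rfl, by push_cast; omega⟩

theorem tails_one_eq (n : ℕ) :
    tails 1 n = (tails 0 n ∪ List.cons (2 * (n : ℤ) + 1, 0) '' tails 0 n) ∪
      List.cons (2 * (n : ℤ) + 1, 1) '' tails 1 n := by
  apply Set.Subset.antisymm
  · intro L hL
    rw [mem_tails_iff (by norm_num)] at hL
    obtain ⟨hL, ⟨r, b⟩, L', rfl, h⟩ := hL
    simp only at h
    by_cases hr : r ≤ 2 * n - 1
    · refine Or.inl (Or.inl ((mem_tails_iff (by norm_num)).2 ⟨hL, _, _, rfl, ?_⟩))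
      simp only
      omega
    · obtain rfl : r = 2 * n + 1 := by omega
      obtain rfl | rfl : b = 0 ∨ b = 1 := by omega
      · exact Or.inl (Or.inr ⟨L', hL, rfl⟩)
      · exact Or.inr ⟨L', hL, rfl⟩
  · rintro _ ((hL | ⟨L, hL, rfl⟩) | ⟨L, hL, rfl⟩)
    · exact tails_zero_subset_one n hL
    · exact (cons_mem_tails_iff (by norm_num) (by norm_num)).2 ⟨hL, by simp⟩
    · exact (cons_mem_tails_iff (by norm_num) (by norm_num)).2 ⟨hL, by simp⟩

theorem tails_zero_succ_eq (n : ℕ) :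
    tails 0 (n + 1) = (tails 1 n ∪ List.cons (2 * (n : ℤ) + 1, 2) '' tails 1 n) ∪
      (fun L => (2 * (n : ℤ) + 1, 2) :: (2 * ((n + 1 : ℕ) : ℤ) + 1, 0) :: L) ''
        tails 0 (n + 1) := by
  apply Set.Subset.antisymm
  · intro L hL
    rw [mem_tails_iff (by norm_num)] at hL
    obtain ⟨hL, ⟨r, b⟩, L', rfl, h⟩ := hL
    simp only at h
    by_cases hr : r = 2 * n + 1 ∧ b = 2
    · obtain ⟨rfl, rfl⟩ := hr
      have hL' : L' ∈ tails 2 n := hL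
      rw [mem_tails_iff (by norm_num)] at hL'
      obtain ⟨hL', ⟨r, b⟩, L', rfl, h⟩ := hL'
      simp only at h
      by_cases hr : r = 2 * ((n + 1 : ℕ) : ℤ) + 1
      · subst hr
        obtain rfl : b = 0 := by omega
        exact Or.inr ⟨L', hL', rfl⟩
      · refine Or.inl (Or.inr ⟨_, (mem_tails_iff (by norm_num)).2 ⟨hL', _, _, rfl, ?_⟩, rfl⟩)
        simp only
        omega
    · refine Or.inl (Or.inl ((mem_tails_iff (by norm_num)).2 ⟨hL, _, _, rfl, ?_⟩))
      simp only
      omega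
  · rintro _ ((hL | ⟨L, hL, rfl⟩) | ⟨L, hL, rfl⟩)
    · exact tails_one_subset_zero_succ n hL
    · refine (cons_mem_tails_iff (by norm_num) (by norm_num)).2 ⟨?_, by push_cast; omega⟩
      rw [mem_tails_iff (by norm_num)] at hL ⊢
      obtain ⟨hL, y, L', rfl, h⟩ := hL
      exact ⟨hL, y, L', rfl, by omega⟩
    · refine (cons_mem_tails_iff (by norm_num) (by norm_num)).2 ⟨?_, by push_cast; omega⟩
      exact (cons_mem_tails_iff (by norm_num) (by norm_num)).2 ⟨hL, by push_cast; omega⟩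

theorem tails_zero_zero : tails 0 0 = {[(-1, 2), (1, 0)]} := by
  ext L
  rw [mem_tails_iff (by norm_num), Set.mem_singleton_iff]
  constructor
  · rintro ⟨hL, y, L', rfl, h⟩
    exact hL.eq_ground_of_neg (by omega)
  · rintro rfl
    exact ⟨.ground, _, _, rfl, by norm_num⟩

theorem tails_zero_monotone : Monotone (tails 0) :=
  monotone_nat_of_le_succ fun n =>
    (tails_zero_subset_one n).trans (tails_one_subset_zero_succ n)

theorem iUnion_tails_zero : ⋃ n, tails 0 n = {L | MG20 L} := by
  ext L
  rw [Set.mem_iUnion, Set.mem_ofPred_eq, mg20_iff_grounded]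
  constructor
  · rintro ⟨n, hn⟩
    exact ((mem_tails (by norm_num)).1 hn).1
  · intro h
    obtain ⟨y, L', rfl, h'⟩ := h.exists_eq_cons
    refine ⟨(y.1 + 1).toNat, (mem_tails_iff (by norm_num)).2 ⟨h, y, L', rfl, ?_⟩⟩
    omega

/-- The weight `C(π) q^{|π|}` of a coloured sequence. -/
noncomputable def weight (q c0 c1 c2 : ℂ) (L : List (ℤ × ℕ)) : ℂ :=
  c0 ^ (L.countP fun p => p.2 == 0) * c1 ^ (L.countP fun p => p.2 == 1) *
    c2 ^ (L.countP fun p => p.2 == 2) * q ^ ((L.map Prod.fst).sum)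

section Weight

variable (q c0 c1 c2 : ℂ)

theorem norm_weight (L : List (ℤ × ℕ)) :
    (‖weight q c0 c1 c2 L‖ : ℂ) = weight ‖q‖ ‖c0‖ ‖c1‖ ‖c2‖ L := by
  simp [weight]

variable {q c0 c1 c2} in
theorem zpow_sum_cons {a n : ℕ} {L : List (ℤ × ℕ)} (hL : Grounded L) :
    q ^ ((((2 * (n : ℤ) + 1, a) :: L).map Prod.fst).sum) =
      q ^ (2 * n + 1) * q ^ ((L.map Prod.fst).sum) := by
  have h := hL.sum_nonneg
  rw [List.map_cons, List.sum_cons, zpow_add' (Or.inr (Or.inl (by simp only; omega)))]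
  norm_cast

theorem weight_cons_zero (n : ℕ) {L : List (ℤ × ℕ)} (hL : Grounded L) :
    weight q c0 c1 c2 ((2 * (n : ℤ) + 1, 0) :: L) =
      c0 * q ^ (2 * n + 1) * weight q c0 c1 c2 L := by
  rw [weight, weight, zpow_sum_cons hL]
  simp only [List.countP_cons]
  simp
  ring

theorem weight_cons_one (n : ℕ) {L : List (ℤ × ℕ)} (hL : Grounded L) :
    weight q c0 c1 c2 ((2 * (n : ℤ) + 1, 1) :: L) =
      c1 * q ^ (2 * n + 1) * weight q c0 c1 c2 L := by
  rw [weight, weight, zpow_sum_cons hL]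
  simp only [List.countP_cons]
  simp
  ring

theorem weight_cons_two (n : ℕ) {L : List (ℤ × ℕ)} (hL : Grounded L) :
    weight q c0 c1 c2 ((2 * (n : ℤ) + 1, 2) :: L) =
      c2 * q ^ (2 * n + 1) * weight q c0 c1 c2 L := by
  rw [weight, weight, zpow_sum_cons hL]
  simp only [List.countP_cons]
  simp
  ring

end Weight

theorem norm_mul_pow_lt_one {c q : ℂ} (hq : ‖q‖ < 1) (hc : ‖c‖ ≤ 1) {n : ℕ} (hn : n ≠ 0) :
    ‖c * q ^ n‖ < 1 := by
  rw [norm_mul, norm_pow]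
  exact mul_lt_one_of_nonneg_of_lt_one_right hc (by positivity)
    (pow_lt_one₀ (norm_nonneg _) hq hn)

theorem Grounded.of_mem_tails {a n : ℕ} {L : List (ℤ × ℕ)} (ha : a ≤ 2) (h : L ∈ tails a n) :
    Grounded L :=
  ((mem_tails ha).1 h).1

section Sums

variable {q c0 c1 c2 : ℂ} (hq : ‖q‖ < 1) {n : ℕ} {S : ℂ}
include hq

theorem hasSum_weight_tails_one (h1 : ‖c1‖ ≤ 1)
    (hS : HasSum (fun L : tails 0 n => weight q c0 c1 c2 L) S) :
    HasSum (fun L : tails 1 n => weight q c0 c1 c2 L)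
      (S * (1 + c0 * q ^ (2 * n + 1)) / (1 - c1 * q ^ (2 * n + 1))) := by
  refine HasSum.div_one_sub_of_eq_union_image List.cons_injective (tails_one_eq n) ?_
    (m := List.length) (by simp)
    (fun L hL => weight_cons_one q c0 c1 c2 n (.of_mem_tails (by norm_num) hL))
    (norm_mul_pow_lt_one hq h1 (by simp)) ?_
  · rw [Set.disjoint_left]
    rintro _ (hL | ⟨L, hL, rfl⟩) ⟨K, hK, hKL⟩
    · rw [← hKL, cons_mem_tails_iff (by norm_num) (by norm_num)] at hL
      omega
    · simp at hKL
  · rw [mul_one_add, mul_comm S (c0 * _)]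
    refine HasSum.union_image_of_eq_mul List.cons_injective ?_
      (fun L hL => weight_cons_zero q c0 c1 c2 n (.of_mem_tails (by norm_num) hL)) hS hS
    rw [Set.disjoint_left]
    rintro _ hL ⟨K, hK, rfl⟩
    rw [cons_mem_tails_iff (by norm_num) (by norm_num)] at hL
    omega

theorem hasSum_weight_tails_zero_succ (h0 : ‖c0‖ ≤ 1) (h2 : ‖c2‖ ≤ 1)
    (hS : HasSum (fun L : tails 1 n => weight q c0 c1 c2 L) S) :
    HasSum (fun L : tails 0 (n + 1) => weight q c0 c1 c2 L)
      (S * (1 + c2 * q ^ (2 * n + 1)) / (1 - c0 * c2 * q ^ (4 * n + 4))) := by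
  refine HasSum.div_one_sub_of_eq_union_image (fun K L h => by simpa using h)
    (tails_zero_succ_eq n) ?_ (m := List.length) (fun L => by simp) (fun L hL => ?_)
    (norm_mul_pow_lt_one hq ?_ (by simp)) ?_
  · rw [Set.disjoint_left]
    rintro _ (hL | ⟨L, hL, rfl⟩) ⟨K, hK, hKL⟩
    · rw [← hKL, cons_mem_tails_iff (by norm_num) (by norm_num)] at hL
      omega
    · obtain rfl := (List.cons.inj hKL).2
      rw [cons_mem_tails_iff (by norm_num) (by norm_num)] at hL
      push_cast at hL
      omega
  · have hL' : Grounded ((2 * ((n + 1 : ℕ) : ℤ) + 1, 0) :: L) := hL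
    rw [weight_cons_two _ _ _ _ _ hL',
      weight_cons_zero _ _ _ _ _ (.of_mem_tails (by norm_num) hL)]
    ring
  · rw [norm_mul]
    exact mul_le_one₀ h0 (norm_nonneg _) h2
  · rw [mul_one_add, mul_comm S (c2 * _)]
    refine HasSum.union_image_of_eq_mul List.cons_injective ?_
      (fun L hL => weight_cons_two q c0 c1 c2 n (.of_mem_tails (by norm_num) hL)) hS hS
    rw [Set.disjoint_left]
    rintro _ hL ⟨K, hK, rfl⟩
    rw [cons_mem_tails_iff (by norm_num) (by norm_num)] at hL
    omega

theorem hasSum_weight_tails_zero (h0 : ‖c0‖ ≤ 1) (h1 : ‖c1‖ ≤ 1) (h2 : ‖c2‖ ≤ 1) (n : ℕ) :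
    HasSum (fun L : tails 0 n => weight q c0 c1 c2 L)
      (c0 * c2 * (∏ k ∈ Finset.range n, (1 - -c0 * q * (q ^ 2) ^ k)) *
        (∏ k ∈ Finset.range n, (1 - -c2 * q * (q ^ 2) ^ k)) /
        ((∏ k ∈ Finset.range n, (1 - c1 * q * (q ^ 2) ^ k)) *
          ∏ k ∈ Finset.range n, (1 - c0 * c2 * q ^ 4 * (q ^ 4) ^ k))) := by
  induction n with
  | zero =>
    rw [tails_zero_zero]
    convert hasSum_unique (fun L : ({[(-1, 2), (1, 0)]} : Set (List (ℤ × ℕ))) =>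
      weight q c0 c1 c2 L) using 1
    simp [weight]
  | succ n ih =>
    convert hasSum_weight_tails_zero_succ hq h0 h2 (hasSum_weight_tails_one hq h1 ih) using 1
    simp only [Finset.prod_range_succ, div_mul_eq_mul_div, div_div]
    congr 1 <;> ring

end Sums

/-- The sum over an increasing union of sets is the limit of the sums over these sets, provided
that the sums of the norms converge as well. -/
theorem hasSum_iUnion_of_monotone {α : Type*} {A : ℕ → Set α} (hA : Monotone A) {f : α → ℂ}
    {s t : ℕ → ℂ} {l l' : ℂ} (hs : ∀ n, HasSum (fun x : A n => f x) (s n))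
    (ht : ∀ n, HasSum (fun x : A n => (‖f x‖ : ℂ)) (t n)) (hsl : Tendsto s atTop (𝓝 l))
    (htl : Tendsto t atTop (𝓝 l')) : HasSum (fun x : ⋃ n, A n => f x) l := by
  obtain ⟨C, hC⟩ := htl.norm.bddAbove_range
  have hnorm : ∀ n, HasSum (Set.indicator (A n) fun x => ‖f x‖) ‖t n‖ := by
    intro n
    have h1 : Summable fun x : A n => ‖f x‖ := (hs n).summable.norm
    have h2 : (t n) = ((∑' x : A n, ‖f x‖ : ℝ) : ℂ) := by
      rw [Complex.ofReal_tsum, (ht n).tsum_eq]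
    rw [← hasSum_subtype_iff_indicator, h2, Complex.norm_of_nonneg (by positivity)]
    exact h1.hasSum
  have hsum : Summable (Set.indicator (⋃ n, A n) fun x => ‖f x‖) := by
    refine summable_of_sum_le (c := C) (fun x => Set.indicator_nonneg (fun _ _ => norm_nonneg _) x)
      fun u => ?_
    have hlim : Tendsto (fun n => ∑ x ∈ u, Set.indicator (A n) (fun x => ‖f x‖) x) atTop
        (𝓝 (∑ x ∈ u, Set.indicator (⋃ n, A n) (fun x => ‖f x‖) x)) :=
      tendsto_finsetSum _ fun x _ => hA.tendsto_indicator A _ x |>.mono_right (by simp)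
    refine le_of_tendsto' hlim fun n => ?_
    exact ((hnorm n).summable.sum_le_tsum u fun x _ =>
      Set.indicator_nonneg (fun _ _ => norm_nonneg _) x).trans
        ((hnorm n).tsum_eq ▸ hC ⟨n, rfl⟩)
  have hlim := tendsto_tsum_of_dominated_convergence (𝓕 := atTop)
    (f := fun n => Set.indicator (A n) f) (g := Set.indicator (⋃ n, A n) f) hsum
    (fun x => hA.tendsto_indicator A f x |>.mono_right (by simp))
    (Eventually.of_forall fun n x => by
      rw [norm_indicator_eq_indicator_norm]
      exact Set.indicator_le_indicator_of_subset (Set.subset_iUnion A n)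
        (fun _ => norm_nonneg _) x)
  have hs' : (fun n => ∑' x, Set.indicator (A n) f x) = s :=
    funext fun n => (hasSum_subtype_iff_indicator.1 (hs n)).tsum_eq
  rw [hs'] at hlim
  have hsum' : Summable (Set.indicator (⋃ n, A n) f) :=
    .of_norm (by simpa only [norm_indicator_eq_indicator_norm] using hsum)
  exact hasSum_subtype_iff_indicator.2 (tendsto_nhds_unique hlim hsl ▸ hsum'.hasSum)

theorem summable_norm_neg_mul_pow (a : ℂ) {q : ℂ} (hq : ‖q‖ < 1) :
    Summable fun k : ℕ => ‖-(a * q ^ k)‖ := by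
  simpa using (summable_geometric_of_lt_one (norm_nonneg q) hq).mul_left ‖a‖

theorem tendsto_prod_qPoch (a : ℂ) {q : ℂ} (hq : ‖q‖ < 1) :
    Tendsto (fun n => ∏ k ∈ Finset.range n, (1 - a * q ^ k)) atTop (𝓝 (qPoch a q)) := by
  have h := multipliable_one_add_of_summable (summable_norm_neg_mul_pow a hq)
  simp only [← sub_eq_add_neg] at h
  exact h.hasProd.tendsto_prod_nat

theorem qPoch_ne_zero {a q : ℂ} (ha : ‖a‖ < 1) (hq : ‖q‖ < 1) : qPoch a q ≠ 0 := by
  have h := tprod_one_add_ne_zero_of_summable (f := fun k : ℕ => -(a * q ^ k)) (fun k hk => ?_)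
    (summable_norm_neg_mul_pow a hq)
  · simp only [← sub_eq_add_neg] at h
    exact h
  · have hlt : ‖a * q ^ k‖ < 1 := by
      rw [norm_mul, norm_pow]
      exact mul_lt_one_of_nonneg_of_lt_one_left (norm_nonneg _) ha
        (pow_le_one₀ (norm_nonneg _) hq.le)
    rw [← sub_eq_add_neg, sub_eq_zero] at hk
    rw [← hk, norm_one] at hlt
    exact lt_irrefl _ hlt

theorem tendsto_prod_div_qPoch {q c0 c1 c2 : ℂ} (hq : ‖q‖ < 1)
    (h0 : ‖c0‖ ≤ 1) (h1 : ‖c1‖ ≤ 1) (h2 : ‖c2‖ ≤ 1) :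
    Tendsto (fun n => c0 * c2 * (∏ k ∈ Finset.range n, (1 - -c0 * q * (q ^ 2) ^ k)) *
        (∏ k ∈ Finset.range n, (1 - -c2 * q * (q ^ 2) ^ k)) /
        ((∏ k ∈ Finset.range n, (1 - c1 * q * (q ^ 2) ^ k)) *
          ∏ k ∈ Finset.range n, (1 - c0 * c2 * q ^ 4 * (q ^ 4) ^ k))) atTop
      (𝓝 (c0 * c2 * qPoch (-c0 * q) (q ^ 2) * qPoch (-c2 * q) (q ^ 2) /
        (qPoch (c1 * q) (q ^ 2) * qPoch (c0 * c2 * q ^ 4) (q ^ 4)))) := by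
  have hpow : ∀ k ≠ 0, ‖q ^ k‖ < 1 := fun k hk => by
    simpa using norm_mul_pow_lt_one (c := 1) hq (by simp) hk
  have hq2 := hpow 2 two_ne_zero
  have hq4 := hpow 4 four_ne_zero
  refine ((tendsto_const_nhds.mul (tendsto_prod_qPoch _ hq2)).mul (tendsto_prod_qPoch _ hq2)).div
    ((tendsto_prod_qPoch _ hq2).mul (tendsto_prod_qPoch _ hq4))
    (mul_ne_zero (qPoch_ne_zero ?_ hq2) (qPoch_ne_zero (norm_mul_pow_lt_one hq ?_ four_ne_zero) hq4))
  · simpa using norm_mul_pow_lt_one hq h1 one_ne_zero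
  · rw [norm_mul]
    exact mul_le_one₀ h0 (norm_nonneg _) h2

/-- The generating function of multi-grounded partitions in `²𝒫^≫_{c_2 c_0}`:
`∑_π C(π) q^{|π|}
  = c_0 c_2 (−c_0 q; q²)_∞ (−c_2 q; q²)_∞ / ((c_1 q; q²)_∞ (c_0 c_2 q⁴; q⁴)_∞)`. -/
theorem mg20GenFun (q c0 c1 c2 : ℂ) (hq : ‖q‖ < 1)
    (h0 : ‖c0‖ ≤ 1) (h1 : ‖c1‖ ≤ 1) (h2 : ‖c2‖ ≤ 1) :
    genFun MG20 q c0 c1 c2 =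
      c0 * c2 * qPoch (-c0 * q) (q ^ 2) * qPoch (-c2 * q) (q ^ 2) /
        (qPoch (c1 * q) (q ^ 2) * qPoch (c0 * c2 * q ^ 4) (q ^ 4)) := by
  have h : HasSum (fun L : ⋃ n, tails 0 n => weight q c0 c1 c2 L) _ :=
    hasSum_iUnion_of_monotone tails_zero_monotone
      (hasSum_weight_tails_zero hq h0 h1 h2)
      (fun n => by
        simp only [norm_weight]
        exact hasSum_weight_tails_zero (by simpa) (by simpa) (by simpa) (by simpa) n)
      (tendsto_prod_div_qPoch hq h0 h1 h2)
      (tendsto_prod_div_qPoch (by simpa) (by simpa) (by simpa) (by simpa))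
  rw [iUnion_tails_zero] at h
  exact h.tsum_eq
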